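/- For every perfect secret sharing scheme Σ for the access structure V1 = Γ_{v1} induced by the Vamos matroid with dealer v1, the information rate satisfies ρ(Σ) ≤ 19/21; consequently ρ(V1) ≤ 19/21. -/

import Mathlib

open MeasureTheory Finset

/-- Shannon entropy of a random variable with values in a finite type:
`H(f) = ∑ₐ −P(f = a)·log P(f = a)`. -/
noncomputable def shannonEntropy {Ω : Type} [MeasurableSpace Ω] {α : Type} [Fintype α]
    (μ : Measure Ω) (f : Ω → α) : ℝ :=
  ∑ a : α, Real.negMulLog ((μ (f ⁻¹' {a})).toReal)

/-- A family of random variables on a common probability space: one (finite-valued)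
random variable `secret` for the secret, and one random variable `share p` for the
share of each participant `p`. -/
structure Scheme (P : Type) [Fintype P] [DecidableEq P] where
  (Ω : Type)
  [mΩ : MeasurableSpace Ω]
  (μ : Measure Ω)
  [prob : IsProbabilityMeasure μ]
  (SecT : Type)
  [secFin : Fintype SecT]
  (ShT : P → Type)
  [shFin : ∀ p, Fintype (ShT p)]
  (secret : Ω → SecT)
  (share : (p : P) → Ω → ShT p)
  (secret_meas : ∀ s : Set SecT, MeasurableSet (secret ⁻¹' s))
  (share_meas : ∀ p, ∀ s : Set (ShT p), MeasurableSet (share p ⁻¹' s))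

namespace Scheme

variable {P : Type} [Fintype P] [DecidableEq P]

/-- `H(S)`: the entropy of the secret. -/
noncomputable def Hsec (S : Scheme P) : ℝ :=
  letI := S.mΩ; letI := S.secFin
  shannonEntropy S.μ S.secret

/-- `H(X)`: the joint entropy of the shares of the participants in `X`. -/
noncomputable def Hset (S : Scheme P) (X : Finset P) : ℝ :=
  letI := S.mΩ; letI := S.shFin
  shannonEntropy S.μ (fun ω => fun p : {y // y ∈ X} => S.share p.1 ω)

/-- `H(X ∪ {S})`: the joint entropy of the shares of the participants in `X`
together with the secret. -/
noncomputable def HsetS (S : Scheme P) (X : Finset P) : ℝ :=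
  letI := S.mΩ; letI := S.secFin; letI := S.shFin
  shannonEntropy S.μ (fun ω => ((fun p : {y // y ∈ X} => S.share p.1 ω), S.secret ω))

/-- The normalized entropy `h(X) = H(X)/H(S)`. -/
noncomputable def hset (S : Scheme P) (X : Finset P) : ℝ := S.Hset X / S.Hsec

/-- The conditional normalized entropy `h(X|Y) = h(X ∪ Y) − h(Y)`. -/
noncomputable def hcond (S : Scheme P) (X Y : Finset P) : ℝ :=
  S.hset (X ∪ Y) - S.hset Y

/-- `Σ` is a perfect secret sharing scheme for the access structure `Γ`:
the conditional entropy `H(S|X) = H(X ∪ {S}) − H(X)` equals `0` for every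
qualified set `X` and equals `H(S)` for every unqualified set `X`. -/
def IsPerfect (S : Scheme P) (Γ : Finset P → Prop) : Prop :=
  (∀ X : Finset P, Γ X → S.HsetS X - S.Hset X = 0) ∧
  (∀ X : Finset P, ¬ Γ X → S.HsetS X - S.Hset X = S.Hsec)

end Scheme
/-- The four Vamos pairs `A = {v₁,v₂}`, `B = {v₃,v₄}`, `C = {v₅,v₆}`, `D = {v₇,v₈}`,
where participant `vᵢ` is represented by `(i-1 : Fin 8)`. -/
def pairA : Finset (Fin 8) := {0, 1}
def pairB : Finset (Fin 8) := {2, 3}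
def pairC : Finset (Fin 8) := {4, 5}
def pairD : Finset (Fin 8) := {6, 7}

/-- `X` is one of the four Vamos pairs. -/
def IsVamosPair (X : Finset (Fin 8)) : Prop :=
  X = pairA ∨ X = pairB ∨ X = pairC ∨ X = pairD

/-- The dependent sets of the Vamos matroid: the five special four-element sets
`AB`, `AC`, `BC`, `BD`, `CD`, and all sets with at least five elements. -/
def VamosDep (X : Finset (Fin 8)) : Prop :=
  X = pairA ∪ pairB ∨ X = pairA ∪ pairC ∨ X = pairB ∪ pairC ∨
    X = pairB ∪ pairD ∨ X = pairC ∪ pairD ∨ 5 ≤ X.card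

/-- The circuits of the Vamos matroid: minimal dependent sets. -/
def VamosCircuit (X : Finset (Fin 8)) : Prop :=
  VamosDep X ∧ ∀ Y ⊂ X, ¬ VamosDep Y

/-- The access structure `Γₓ` induced by the Vamos matroid with dealer `x`
(the dealer is regarded as a participant who is individually qualified):
a set is qualified iff it contains a minimal qualified set, the minimal
qualified sets being `{x}` and the sets `M ⊆ Q \ {x}` with `M ∪ {x}` a circuit. -/
def VamosQualified (x : Fin 8) (Y : Finset (Fin 8)) : Prop :=
  x ∈ Y ∨ ∃ M ⊆ Y, x ∉ M ∧ VamosCircuit (insert x M)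

/-- `λ = (max₁≤ᵢ≤₈ h({vᵢ})) − 1`. -/
noncomputable def Scheme.lam (S : Scheme (Fin 8)) : ℝ :=
  (Finset.univ.sup' Finset.univ_nonempty fun i : Fin 8 => S.hset {i}) - 1

/-- The information rate `ρ(Σ) = min₁≤ᵢ≤₈ H(S)/H(vᵢ)` of a scheme. -/
noncomputable def Scheme.rho (S : Scheme (Fin 8)) : ℝ :=
  Finset.univ.inf' Finset.univ_nonempty fun i : Fin 8 => S.Hsec / S.Hset {i}

/-- The law on a finite space induced by a map. -/
noncomputable def law {Ω₀ Ω : Type} [MeasurableSpace Ω₀] (μ : Measure Ω₀)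
    (f : Ω₀ → Ω) (x : Ω) : ℝ :=
  μ.real (f ⁻¹' {x})

lemma sum_law {Ω₀ Ω : Type} [MeasurableSpace Ω₀] (μ : Measure Ω₀) [IsProbabilityMeasure μ]
    {f : Ω₀ → Ω} (hf : ∀ x, MeasurableSet (f ⁻¹' {x})) (s : Finset Ω) :
    ∑ x ∈ s, law μ f x = μ.real (f ⁻¹' s) := by
  have : f ⁻¹' s = ⋃ x ∈ s, f ⁻¹' {x} := by ext; simp
  rw [this, measureReal_biUnion_finset]
  · rfl
  · exact fun x _ y _ hxy => Disjoint.preimage _ (by simpa using hxy)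
  · exact fun x _ => hf x

lemma finset_inf_rel {ι α : Type} (V : ι → Setoid α) (I : Finset ι) (x y : α) :
    (I.inf V) x y ↔ ∀ i ∈ I, V i x y := by
  classical
  induction I using Finset.induction_on with
  | empty => exact ⟨fun _ i hi => absurd hi (Finset.notMem_empty i), fun _ => trivial⟩
  | insert i I _ ih => rw [Finset.inf_insert, Finset.forall_mem_insert, ← ih]; rfl

section Entropy

open scoped Classical

variable {Ω : Type} [Fintype Ω]

/-- The total weight of the `r`-class of `x`. -/
noncomputable def classMass (p : Ω → ℝ) (r : Setoid Ω) (x : Ω) : ℝ :=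
  ∑ y, if r x y then p y else 0

/-- The entropy of the partition of a weighted finite space into the classes of `r`. -/
noncomputable def partitionEntropy (p : Ω → ℝ) (r : Setoid Ω) : ℝ :=
  -∑ x, p x * Real.log (classMass p r x)

lemma classMass_nonneg {p : Ω → ℝ} (hp : ∀ x, 0 ≤ p x) (r : Setoid Ω) (x : Ω) :
    0 ≤ classMass p r x :=
  Finset.sum_nonneg fun y _ => by split_ifs <;> simp [hp]

lemma le_classMass {p : Ω → ℝ} (hp : ∀ x, 0 ≤ p x) (r : Setoid Ω) (x : Ω) :
    p x ≤ classMass p r x := by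
  have := Finset.single_le_sum (f := fun y => if r x y then p y else 0)
    (fun y _ => by split_ifs <;> simp [hp]) (Finset.mem_univ x)
  simpa [classMass, r.refl' x] using this

lemma classMass_mono {p : Ω → ℝ} (hp : ∀ x, 0 ≤ p x) {r s : Setoid Ω} (h : r ≤ s) (x : Ω) :
    classMass p r x ≤ classMass p s x := by
  refine Finset.sum_le_sum fun y _ => ?_
  by_cases hr : r x y
  · simp [hr, h hr]
  · simp only [hr, if_false]
    split_ifs <;> simp [hp]

lemma classMass_eq_of_rel (p : Ω → ℝ) {r : Setoid Ω} {x y : Ω} (h : r x y) :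
    classMass p r x = classMass p r y := by
  refine Finset.sum_congr rfl fun z _ => ?_
  have : r x z ↔ r y z := ⟨fun hz => r.trans' (r.symm' h) hz, fun hz => r.trans' h hz⟩
  simp [this]

lemma partitionEntropy_anti {p : Ω → ℝ} (hp : ∀ x, 0 ≤ p x) {r s : Setoid Ω} (h : r ≤ s) :
    partitionEntropy p s ≤ partitionEntropy p r := by
  refine neg_le_neg (Finset.sum_le_sum fun x _ => ?_)
  rcases (hp x).eq_or_lt with h0 | h0
  · simp [← h0]
  · exact mul_le_mul_of_nonneg_left
      (Real.log_le_log (h0.trans_le (le_classMass hp r x)) (classMass_mono hp h x)) h0.le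

lemma partitionEntropy_top {p : Ω → ℝ} (h1 : ∑ x, p x = 1) : partitionEntropy p ⊤ = 0 := by
  have (x : Ω) : classMass p ⊤ x = 1 := by
    rw [← h1]; exact Finset.sum_congr rfl fun y _ => if_pos trivial
  simp [partitionEntropy, this]

lemma partitionEntropy_congr {p : Ω → ℝ} {r s : Setoid Ω}
    (h : ∀ x y, p x ≠ 0 → p y ≠ 0 → (r x y ↔ s x y)) :
    partitionEntropy p r = partitionEntropy p s := by
  refine congrArg Neg.neg (Finset.sum_congr rfl fun x _ => ?_)
  by_cases hx : p x = 0
  · simp [hx]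
  · have : classMass p r x = classMass p s x := by
      refine Finset.sum_congr rfl fun y _ => ?_
      by_cases hy : p y = 0
      · simp [hy]
      · simp [h x y hx hy]
    rw [this]

lemma sum_mul_div_classMass_le {p : Ω → ℝ} (hp : ∀ x, 0 ≤ p x) {r s t : Setoid Ω}
    (hr : r ≤ t) (hs : s ≤ t) :
    ∑ x, p x * (classMass p r x * classMass p s x /
      (classMass p (r ⊓ s) x * classMass p t x)) ≤ ∑ x, p x := by
  have inner (y z : Ω) :
      (∑ x, if r x y ∧ s x z then p x / (classMass p (r ⊓ s) x * classMass p t x) else 0)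
        ≤ if t y z then 1 / classMass p t y else 0 := by
    by_cases hex : ∃ x, r x y ∧ s x z
    · obtain ⟨w, hwy, hwz⟩ := hex
      have hyz : t y z := t.trans' (t.symm' (hr hwy)) (hs hwz)
      have key (x : Ω) :
          (if r x y ∧ s x z then p x / (classMass p (r ⊓ s) x * classMass p t x) else 0)
            = (if (r ⊓ s) w x then p x else 0) / (classMass p (r ⊓ s) w * classMass p t y) := by
        have hiff : (r x y ∧ s x z) ↔ (r ⊓ s) w x :=
          ⟨fun h => ⟨r.trans' hwy (r.symm' h.1), s.trans' hwz (s.symm' h.2)⟩,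
            fun h => ⟨r.trans' (r.symm' h.1) hwy, s.trans' (s.symm' h.2) hwz⟩⟩
        by_cases hx : (r ⊓ s) w x
        · rw [if_pos (hiff.2 hx), if_pos hx, classMass_eq_of_rel p hx,
            classMass_eq_of_rel p (hr (hiff.2 hx).1)]
        · rw [if_neg (fun h => hx (hiff.1 h)), if_neg hx, zero_div]
      rw [Finset.sum_congr rfl fun x _ => key x, ← Finset.sum_div, if_pos hyz]
      change classMass p (r ⊓ s) w / _ ≤ _
      rw [div_mul_eq_div_div]
      exact div_le_div_of_nonneg_right (div_self_le_one _) (classMass_nonneg hp t y)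
    · push Not at hex
      rw [Finset.sum_eq_zero fun x _ => if_neg fun h => hex x h.1 h.2]
      split_ifs
      · exact one_div_nonneg.2 (classMass_nonneg hp t y)
      · rfl
  calc ∑ x, p x * (classMass p r x * classMass p s x /
        (classMass p (r ⊓ s) x * classMass p t x))
      = ∑ x, ∑ y, ∑ z, p y * p z * (if r x y ∧ s x z then
          p x / (classMass p (r ⊓ s) x * classMass p t x) else 0) := by
        refine Finset.sum_congr rfl fun x _ => ?_
        have : p x * (classMass p r x * classMass p s x /
            (classMass p (r ⊓ s) x * classMass p t x)) =
            classMass p r x * classMass p s x *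
              (p x / (classMass p (r ⊓ s) x * classMass p t x)) := by ring
        rw [this, classMass, classMass, Finset.sum_mul_sum, Finset.sum_mul]
        refine Finset.sum_congr rfl fun y _ => ?_
        rw [Finset.sum_mul]
        refine Finset.sum_congr rfl fun z _ => ?_
        by_cases h1 : r x y <;> by_cases h2 : s x z <;> simp [h1, h2]
    _ = ∑ y, ∑ z, p y * p z * ∑ x, (if r x y ∧ s x z then
          p x / (classMass p (r ⊓ s) x * classMass p t x) else 0) := by
        rw [Finset.sum_comm]
        refine Finset.sum_congr rfl fun y _ => ?_
        rw [Finset.sum_comm]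
        refine Finset.sum_congr rfl fun z _ => ?_
        rw [Finset.mul_sum]
    _ ≤ ∑ y, ∑ z, p y * p z * (if t y z then 1 / classMass p t y else 0) :=
        Finset.sum_le_sum fun y _ => Finset.sum_le_sum fun z _ =>
          mul_le_mul_of_nonneg_left (inner y z) (mul_nonneg (hp y) (hp z))
    _ = ∑ y, p y * (classMass p t y / classMass p t y) := by
        refine Finset.sum_congr rfl fun y _ => ?_
        nth_rewrite 2 [classMass]
        rw [Finset.sum_div, Finset.mul_sum]
        refine Finset.sum_congr rfl fun z _ => ?_
        split_ifs <;> ring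
    _ ≤ ∑ y, p y := Finset.sum_le_sum fun y _ =>
        mul_le_of_le_one_right (hp y) (div_self_le_one _)

lemma partitionEntropy_submodular {p : Ω → ℝ} (hp : ∀ x, 0 ≤ p x) {r s t : Setoid Ω}
    (hr : r ≤ t) (hs : s ≤ t) :
    partitionEntropy p (r ⊓ s) + partitionEntropy p t ≤
      partitionEntropy p r + partitionEntropy p s := by
  have hterm (x : Ω) : p x * Real.log (classMass p r x) + p x * Real.log (classMass p s x)
      - p x * Real.log (classMass p (r ⊓ s) x) - p x * Real.log (classMass p t x) ≤
      p x * (classMass p r x * classMass p s x /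
        (classMass p (r ⊓ s) x * classMass p t x)) - p x := by
    rcases (hp x).eq_or_lt with h0 | h0
    · simp [← h0]
    · have pos (u : Setoid Ω) : 0 < classMass p u x := h0.trans_le (le_classMass hp u x)
      have hlog := Real.log_le_sub_one_of_pos (div_pos (mul_pos (pos r) (pos s))
        (mul_pos (pos (r ⊓ s)) (pos t)))
      rw [Real.log_div (mul_pos (pos r) (pos s)).ne' (mul_pos (pos (r ⊓ s)) (pos t)).ne',
        Real.log_mul (pos r).ne' (pos s).ne', Real.log_mul (pos (r ⊓ s)).ne' (pos t).ne'] at hlog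
      have := mul_le_mul_of_nonneg_left hlog h0.le
      linarith
  have hsum := Finset.sum_le_sum fun x (_ : x ∈ Finset.univ) => hterm x
  simp only [Finset.sum_sub_distrib, Finset.sum_add_distrib] at hsum
  have := sum_mul_div_classMass_le hp hr hs
  simp only [partitionEntropy]
  linarith

/-- The weight on `Ω × Ω` making the two coordinates copies of the original space that
agree up to `t` and are conditionally independent given the class of `t`. -/
noncomputable def copyWeight (p : Ω → ℝ) (t : Setoid Ω) (z : Ω × Ω) : ℝ :=
  if t z.1 z.2 then p z.1 * p z.2 / classMass p t z.1 else 0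

lemma copyWeight_nonneg {p : Ω → ℝ} (hp : ∀ x, 0 ≤ p x) (t : Setoid Ω) (z : Ω × Ω) :
    0 ≤ copyWeight p t z := by
  unfold copyWeight
  split_ifs
  · exact div_nonneg (mul_nonneg (hp _) (hp _)) (classMass_nonneg hp t _)
  · rfl

lemma copyWeight_swap (p : Ω → ℝ) (t : Setoid Ω) (x y : Ω) :
    copyWeight p t (x, y) = copyWeight p t (y, x) := by
  unfold copyWeight
  by_cases h : t x y
  · simp only [h, t.symm' h, if_true, classMass_eq_of_rel p h, mul_comm (p x)]
  · have h' : ¬ t y x := fun h' => h (t.symm' h')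
    simp [h, h']

lemma sum_copyWeight_right {p : Ω → ℝ} (hp : ∀ x, 0 ≤ p x) (t : Setoid Ω) (x : Ω) :
    ∑ y, copyWeight p t (x, y) = p x := by
  have : ∑ y, copyWeight p t (x, y) = p x * (classMass p t x / classMass p t x) := by
    nth_rewrite 1 [classMass]
    rw [Finset.sum_div, Finset.mul_sum]
    refine Finset.sum_congr rfl fun y _ => ?_
    simp only [copyWeight]
    split_ifs <;> ring
  rw [this]
  rcases (hp x).eq_or_lt with h0 | h0
  · simp [← h0]
  · rw [div_self (h0.trans_le (le_classMass hp t x)).ne', mul_one]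

lemma sum_copyWeight_left {p : Ω → ℝ} (hp : ∀ x, 0 ≤ p x) (t : Setoid Ω) (y : Ω) :
    ∑ x, copyWeight p t (x, y) = p y := by
  simp_rw [fun x => copyWeight_swap p t x y]
  exact sum_copyWeight_right hp t y

lemma sum_copyWeight {p : Ω → ℝ} (hp : ∀ x, 0 ≤ p x) (t : Setoid Ω) :
    ∑ z, copyWeight p t z = ∑ x, p x := by
  rw [Fintype.sum_prod_type]
  exact Finset.sum_congr rfl fun x _ => sum_copyWeight_right hp t x

lemma sum_copyWeight_mul_fst {p : Ω → ℝ} (hp : ∀ x, 0 ≤ p x) (t : Setoid Ω) (f : Ω → ℝ) :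
    ∑ z, copyWeight p t z * f z.1 = ∑ x, p x * f x := by
  rw [Fintype.sum_prod_type]
  exact Finset.sum_congr rfl fun x _ => by
    dsimp only
    rw [← Finset.sum_mul, sum_copyWeight_right hp]

lemma sum_copyWeight_mul_snd {p : Ω → ℝ} (hp : ∀ x, 0 ≤ p x) (t : Setoid Ω) (f : Ω → ℝ) :
    ∑ z, copyWeight p t z * f z.2 = ∑ x, p x * f x := by
  rw [Fintype.sum_prod_type_right]
  exact Finset.sum_congr rfl fun x _ => by
    dsimp only
    rw [← Finset.sum_mul, sum_copyWeight_left hp]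

lemma partitionEntropy_copy_fst {p : Ω → ℝ} (hp : ∀ x, 0 ≤ p x) (t r : Setoid Ω) :
    partitionEntropy (copyWeight p t) (r.comap Prod.fst) = partitionEntropy p r := by
  have (z : Ω × Ω) : classMass (copyWeight p t) (r.comap Prod.fst) z = classMass p r z.1 := by
    have := sum_copyWeight_mul_fst hp t fun x => if r z.1 x then 1 else 0
    simpa [classMass, Setoid.comap_rel] using this
  simp only [partitionEntropy, this]
  rw [sum_copyWeight_mul_fst hp t fun x => Real.log (classMass p r x)]

lemma partitionEntropy_copy_snd {p : Ω → ℝ} (hp : ∀ x, 0 ≤ p x) (t r : Setoid Ω) :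
    partitionEntropy (copyWeight p t) (r.comap Prod.snd) = partitionEntropy p r := by
  have (z : Ω × Ω) : classMass (copyWeight p t) (r.comap Prod.snd) z = classMass p r z.2 := by
    have := sum_copyWeight_mul_snd hp t fun x => if r z.2 x then 1 else 0
    simpa [classMass, Setoid.comap_rel] using this
  simp only [partitionEntropy, this]
  rw [sum_copyWeight_mul_snd hp t fun x => Real.log (classMass p r x)]

lemma copyWeight_rel {p : Ω → ℝ} {t : Setoid Ω} {z : Ω × Ω} (h : copyWeight p t z ≠ 0) :
    t z.1 z.2 := by
  by_contra hz
  exact h (if_neg hz)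

lemma partitionEntropy_bot (p : Ω → ℝ) :
    partitionEntropy p ⊥ = -∑ x, p x * Real.log (p x) := by
  have (x : Ω) : classMass p ⊥ x = p x := by
    simp [classMass]
  simp [partitionEntropy, this]

lemma partitionEntropy_copy_bot {p : Ω → ℝ} (hp : ∀ x, 0 ≤ p x) (t : Setoid Ω) :
    partitionEntropy (copyWeight p t) ⊥ = 2 * partitionEntropy p ⊥ - partitionEntropy p t := by
  have key (z : Ω × Ω) : copyWeight p t z * Real.log (copyWeight p t z) =
      copyWeight p t z * Real.log (p z.1) + copyWeight p t z * Real.log (p z.2)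
        - copyWeight p t z * Real.log (classMass p t z.1) := by
    by_cases h0 : copyWeight p t z = 0
    · simp [h0]
    · have ht := copyWeight_rel h0
      have h0' := h0
      simp only [copyWeight, ht, if_true] at h0'
      have h1 : p z.1 ≠ 0 := fun h => h0' (by simp [h])
      have h2 : p z.2 ≠ 0 := fun h => h0' (by simp [h])
      have h3 : classMass p t z.1 ≠ 0 := fun h => h0' (by simp [h])
      have : Real.log (copyWeight p t z) =
          Real.log (p z.1) + Real.log (p z.2) - Real.log (classMass p t z.1) := by
        simp only [copyWeight, ht, if_true]
        rw [Real.log_div (mul_ne_zero h1 h2) h3, Real.log_mul h1 h2]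
      rw [this]; ring
  rw [partitionEntropy_bot, partitionEntropy_bot, Finset.sum_congr rfl fun z _ => key z]
  rw [Finset.sum_sub_distrib, Finset.sum_add_distrib,
    sum_copyWeight_mul_fst hp t fun x => Real.log (p x),
    sum_copyWeight_mul_snd hp t fun x => Real.log (p x),
    sum_copyWeight_mul_fst hp t fun x => Real.log (classMass p t x), partitionEntropy]
  ring

lemma comap_le_comap {α β : Type} (f : α → β) {r s : Setoid β} (h : r ≤ s) :
    r.comap f ≤ s.comap f :=
  fun _ _ h' => h h'

lemma comap_inf_comap {α β : Type} (f : α → β) (r s : Setoid β) :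
    (r ⊓ s).comap f = r.comap f ⊓ s.comap f :=
  rfl

lemma partitionEntropy_copy_inf {p : Ω → ℝ} (hp : ∀ x, 0 ≤ p x) (t r s : Setoid Ω) :
    partitionEntropy p r + partitionEntropy p s ≤
      partitionEntropy (copyWeight p t) (r.comap Prod.fst ⊓ s.comap Prod.snd)
        + partitionEntropy p t := by
  have hq := copyWeight_nonneg hp t
  have h1 := partitionEntropy_submodular hq
    (r := (⊥ : Setoid Ω).comap Prod.fst ⊓ s.comap Prod.snd)
    (s := (⊥ : Setoid Ω).comap Prod.snd) (t := s.comap Prod.snd) inf_le_right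
    (comap_le_comap _ bot_le)
  have h2 := partitionEntropy_submodular hq
    (r := r.comap Prod.fst ⊓ s.comap Prod.snd)
    (s := (⊥ : Setoid Ω).comap Prod.fst) (t := r.comap Prod.fst) inf_le_left
    (comap_le_comap _ bot_le)
  have h3 := partitionEntropy_anti hq (s := ⊥)
    (r := ((⊥ : Setoid Ω).comap Prod.fst ⊓ s.comap Prod.snd) ⊓ (⊥ : Setoid Ω).comap Prod.snd)
    fun _ _ h => Prod.ext h.1.1 h.2
  have h4 := partitionEntropy_anti hq
    (r := (r.comap Prod.fst ⊓ s.comap Prod.snd) ⊓ (⊥ : Setoid Ω).comap Prod.fst)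
    (s := (⊥ : Setoid Ω).comap Prod.fst ⊓ s.comap Prod.snd)
    (le_inf inf_le_right (inf_le_left.trans inf_le_right))
  have h5 := partitionEntropy_copy_bot hp t
  simp only [partitionEntropy_copy_fst hp, partitionEntropy_copy_snd hp] at h1 h2
  rw [h5] at h3
  linarith

lemma partitionEntropy_copy_inf_of_le {p : Ω → ℝ} {t u : Setoid Ω} (hu : t ≤ u)
    {r : Setoid (Ω × Ω)} (hr : r ≤ u.comap Prod.fst) (s : Setoid Ω) :
    partitionEntropy (copyWeight p t) (r ⊓ s.comap Prod.snd) =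
      partitionEntropy (copyWeight p t) (r ⊓ (s ⊓ u).comap Prod.snd) := by
  refine partitionEntropy_congr fun x y hx hy => ⟨fun h => ⟨h.1, h.2, ?_⟩, fun h => ⟨h.1, h.2.1⟩⟩
  exact u.trans' (u.symm' (hu (copyWeight_rel hx))) (u.trans' (hr h.1) (hu (copyWeight_rel hy)))

/-- The joint entropy of the members of a family of partitions with indices in `I`. -/
noncomputable def jointEntropy {ι : Type} (p : Ω → ℝ) (V : ι → Setoid Ω) (I : Finset ι) : ℝ :=
  partitionEntropy p (I.inf V)

section Family

variable {ι : Type} {p : Ω → ℝ} (V : ι → Setoid Ω)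

lemma jointEntropy_mono (hp : ∀ x, 0 ≤ p x) {I J : Finset ι} (h : I ⊆ J) :
    jointEntropy p V I ≤ jointEntropy p V J :=
  partitionEntropy_anti hp (Finset.inf_mono h)

lemma jointEntropy_submodular [DecidableEq ι] (hp : ∀ x, 0 ≤ p x) (I J : Finset ι)
    {L : Finset ι} (hI : L ⊆ I) (hJ : L ⊆ J) :
    jointEntropy p V (I ∪ J) + jointEntropy p V L ≤ jointEntropy p V I + jointEntropy p V J := by
  simp only [jointEntropy, Finset.inf_union]
  exact partitionEntropy_submodular hp (Finset.inf_mono hI) (Finset.inf_mono hJ)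

lemma jointEntropy_empty (h1 : ∑ x, p x = 1) : jointEntropy p V ∅ = 0 :=
  partitionEntropy_top h1

end Family

/-- The Zhang–Yeung inequality
`2 I(c;d) ≤ I(a;b) + I(a;cd) + 3 I(c;d|a) + I(c;d|b)`. -/
lemma zhangYeung {p : Ω → ℝ} (hp : ∀ x, 0 ≤ p x) (h1 : ∑ x, p x = 1) (a b c d : Setoid Ω) :
    let H := partitionEntropy p
    2 * (H c + H d - H (c ⊓ d)) ≤
      (H a + H b - H (a ⊓ b)) + (H a + H (c ⊓ d) - H (a ⊓ (c ⊓ d)))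
      + 3 * (H (a ⊓ c) + H (a ⊓ d) - H (a ⊓ (c ⊓ d)) - H a)
      + (H (b ⊓ c) + H (b ⊓ d) - H (b ⊓ (c ⊓ d)) - H b) := by
  intro H
  have hq := copyWeight_nonneg hp (c ⊓ d)
  have hq1 : ∑ z, copyWeight p (c ⊓ d) z = 1 := (sum_copyWeight hp _).trans h1
  set V : Fin 5 → Setoid (Ω × Ω) := ![a.comap Prod.fst, b.comap Prod.fst, c.comap Prod.fst,
    d.comap Prod.fst, a.comap Prod.snd] with hV
  set h := jointEntropy (copyWeight p (c ⊓ d)) V with hh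
  have copy (u : Setoid Ω) (hu : c ⊓ d ≤ u) :
      partitionEntropy (copyWeight p (c ⊓ d)) (u.comap Prod.fst ⊓ a.comap Prod.snd)
        = H (a ⊓ u) := by
    rw [← show _ = H (a ⊓ u) from partitionEntropy_copy_snd hp (c ⊓ d) (a ⊓ u)]
    refine partitionEntropy_congr fun x y hx hy => ?_
    have hx' := hu (copyWeight_rel hx)
    have hy' := hu (copyWeight_rel hy)
    exact ⟨fun h => ⟨h.2, u.trans' (u.symm' hx') (u.trans' h.1 hy')⟩,
      fun h => ⟨u.trans' hx' (u.trans' h.2 (u.symm' hy')), h.1⟩⟩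
  have sub (I J K L : Finset (Fin 5)) (hI : L ⊆ I) (hJ : L ⊆ J) (hK : I ∪ J = K) :
      h K + h L ≤ h I + h J := hK ▸ jointEntropy_submodular V hq I J hI hJ
  have indep := partitionEntropy_copy_inf hp (c ⊓ d) (a ⊓ (b ⊓ (c ⊓ d))) (a ⊓ (c ⊓ d))
  rw [← partitionEntropy_copy_inf_of_le le_rfl
    (comap_le_comap _ (inf_le_right.trans inf_le_right))] at indep
  have indep' : H (a ⊓ (b ⊓ (c ⊓ d))) + H (a ⊓ (c ⊓ d)) ≤ h {0, 1, 2, 3, 4} + H (c ⊓ d) := by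
    have : ({0, 1, 2, 3, 4} : Finset (Fin 5)).inf V =
        (a ⊓ (b ⊓ (c ⊓ d))).comap Prod.fst ⊓ a.comap Prod.snd := by
      simp [hV, comap_inf_comap, inf_assoc]
    rwa [hh, jointEntropy, this]
  have eq_fst (I : Finset (Fin 5)) (r : Setoid Ω) (hI : I.inf V = r.comap Prod.fst) :
      h I = H r := by rw [hh, jointEntropy, hI, partitionEntropy_copy_fst hp]
  have e : h ∅ = 0 := jointEntropy_empty V hq1
  have e0 : h {0} = H a := eq_fst _ _ (by simp [hV])
  have e1 : h {1} = H b := eq_fst _ _ (by simp [hV])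
  have e2 : h {2} = H c := eq_fst _ _ (by simp [hV])
  have e3 : h {3} = H d := eq_fst _ _ (by simp [hV])
  have e01 : h {0, 1} = H (a ⊓ b) := eq_fst _ _ (by simp [hV, ← comap_inf_comap])
  have e02 : h {0, 2} = H (a ⊓ c) := eq_fst _ _ (by simp [hV, ← comap_inf_comap])
  have e12 : h {1, 2} = H (b ⊓ c) := eq_fst _ _ (by simp [hV, ← comap_inf_comap])
  have e03 : h {0, 3} = H (a ⊓ d) := eq_fst _ _ (by simp [hV, ← comap_inf_comap])
  have e13 : h {1, 3} = H (b ⊓ d) := eq_fst _ _ (by simp [hV, ← comap_inf_comap])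
  have e013 : h {0, 1, 3} = H (a ⊓ (b ⊓ d)) := eq_fst _ _ (by simp [hV, ← comap_inf_comap])
  have e23 : h {2, 3} = H ((c ⊓ d)) := eq_fst _ _ (by simp [hV, ← comap_inf_comap])
  have e023 : h {0, 2, 3} = H (a ⊓ (c ⊓ d)) := eq_fst _ _ (by simp [hV, ← comap_inf_comap])
  have e123 : h {1, 2, 3} = H (b ⊓ (c ⊓ d)) := eq_fst _ _ (by simp [hV, ← comap_inf_comap])
  have e0123 : h {0, 1, 2, 3} = H (a ⊓ (b ⊓ (c ⊓ d))) :=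
    eq_fst _ _ (by simp [hV, ← comap_inf_comap])
  have e4 : h {4} = H a := by simp [hh, jointEntropy, hV, partitionEntropy_copy_snd hp, H]
  have e24 : h {2, 4} = H (a ⊓ c) := by
    rw [← copy _ (by simp)]; simp [hh, jointEntropy, hV]
  have e34 : h {3, 4} = H (a ⊓ d) := by
    rw [← copy _ (by simp)]; simp [hh, jointEntropy, hV]
  linarith [e, e0, e1, e2, e3, indep', e01, e02, e12, e03, e13, e013, e23, e023, e123, e0123,
    e4, e24, e34,
    sub {0, 3, 4} {0, 2, 4} {0, 2, 3, 4} {0, 4} (by decide) (by decide) (by decide),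
    sub {0, 1, 4} {0, 1, 3} {0, 1, 3, 4} {0, 1} (by decide) (by decide) (by decide),
    sub {1, 3, 4} {1, 2, 4} {1, 2, 3, 4} {1, 4} (by decide) (by decide) (by decide),
    sub {1, 4} {0, 4} {0, 1, 4} {4} (by decide) (by decide) (by decide),
    sub {3, 4} {1, 3} {1, 3, 4} {3} (by decide) (by decide) (by decide),
    sub {0, 2, 3, 4} {0, 1, 2, 3} {0, 1, 2, 3, 4} {0, 2, 3} (by decide) (by decide) (by decide),
    sub {0, 1, 3, 4} {0, 1, 2, 3} {0, 1, 2, 3, 4} {0, 1, 3} (by decide) (by decide) (by decide),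
    sub {1, 2, 3, 4} {0, 1, 2, 3} {0, 1, 2, 3, 4} {1, 2, 3} (by decide) (by decide) (by decide),
    sub {2, 4} {1, 2} {1, 2, 4} {2} (by decide) (by decide) (by decide),
    sub {3, 4} {0, 3} {0, 3, 4} {3} (by decide) (by decide) (by decide),
    sub {2, 4} {0, 2} {0, 2, 4} {2} (by decide) (by decide) (by decide)]

lemma jointEntropy_zhangYeung {ι : Type} [DecidableEq ι] {p : Ω → ℝ} (hp : ∀ x, 0 ≤ p x)
    (h1 : ∑ x, p x = 1) (V : ι → Setoid Ω) (A B C D : Finset ι) :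
    let h := jointEntropy p V
    2 * (h C + h D - h (C ∪ D)) ≤
      (h A + h B - h (A ∪ B)) + (h A + h (C ∪ D) - h (A ∪ (C ∪ D)))
      + 3 * (h (A ∪ C) + h (A ∪ D) - h (A ∪ (C ∪ D)) - h A)
      + (h (B ∪ C) + h (B ∪ D) - h (B ∪ (C ∪ D)) - h B) := by
  simpa only [jointEntropy, Finset.inf_union] using
    zhangYeung hp h1 (A.inf V) (B.inf V) (C.inf V) (D.inf V)

lemma shannonEntropy_comp {Ω₀ β : Type} [MeasurableSpace Ω₀] [Fintype β] (μ : Measure Ω₀)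
    [IsProbabilityMeasure μ] {f : Ω₀ → Ω} (hf : ∀ x, MeasurableSet (f ⁻¹' {x})) (g : Ω → β) :
    shannonEntropy μ (fun ω => g (f ω)) = partitionEntropy (law μ f) (Setoid.ker g) := by
  have hmass (b : β) : (μ ((fun ω => g (f ω)) ⁻¹' {b})).toReal =
      ∑ x with g x = b, law μ f x := by
    rw [sum_law μ hf]
    congr 2
    ext; simp
  have hclass (x : Ω) : classMass (law μ f) (Setoid.ker g) x =
      ∑ y with g y = g x, law μ f y := by
    rw [Finset.sum_filter]
    exact Finset.sum_congr rfl fun y _ => by simp [Setoid.ker_def, eq_comm]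
  simp only [shannonEntropy, partitionEntropy, hmass, hclass, Real.negMulLog]
  rw [← Finset.sum_fiberwise Finset.univ g, ← Finset.sum_neg_distrib]
  refine Finset.sum_congr rfl fun b _ => ?_
  rw [neg_mul, Finset.sum_mul]
  refine congrArg Neg.neg (Finset.sum_congr rfl fun x hx => ?_)
  rw [(Finset.mem_filter.1 hx).2]

end Entropy

namespace Scheme

variable (S : Scheme (Fin 8))

/-- The joint values of the secret and of all shares. -/
abbrev Values : Type := S.SecT × ((i : Fin 8) → S.ShT i)

noncomputable instance : Fintype S.Values :=
  letI := S.secFin; letI := S.shFin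
  inferInstanceAs (Fintype (S.SecT × ((i : Fin 8) → S.ShT i)))

/-- The joint law of the secret and of all shares. -/
noncomputable def jointLaw : S.Values → ℝ :=
  letI := S.mΩ
  law S.μ fun ω => (S.secret ω, fun i => S.share i ω)

/-- The partitions of the joint values by the secret (index `0`) and by the shares of the
participants other than the dealer. -/
noncomputable def dealerFamily (i : Fin 8) : Setoid S.Values :=
  if i = 0 then Setoid.ker Prod.fst else Setoid.ker fun w => w.2 i

/-- The joint entropy of a set of participants, the share of the dealer being replaced by
the secret. -/
noncomputable def dealerEntropy (X : Finset (Fin 8)) : ℝ :=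
  jointEntropy S.jointLaw S.dealerFamily X

lemma measurableSet_values_preimage (x : S.Values) :
    letI := S.mΩ
    MeasurableSet ((fun ω => ((S.secret ω, fun i => S.share i ω) : S.Values)) ⁻¹' {x}) := by
  let := S.mΩ
  have : (fun ω => ((S.secret ω, fun i => S.share i ω) : S.Values)) ⁻¹' {x} =
      S.secret ⁻¹' {x.1} ∩ ⋂ i, S.share i ⁻¹' {x.2 i} := by
    ext ω
    simp [Prod.ext_iff, funext_iff]
  rw [this]
  exact (S.secret_meas _).inter (MeasurableSet.iInter fun i => S.share_meas i _)

lemma jointLaw_nonneg (x : S.Values) : 0 ≤ S.jointLaw x := ENNReal.toReal_nonneg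

lemma sum_jointLaw : ∑ x, S.jointLaw x = 1 := by
  let := S.mΩ
  let := S.prob
  simp [jointLaw, sum_law S.μ S.measurableSet_values_preimage]

lemma inf_dealerFamily {X : Finset (Fin 8)} (hX : 0 ∉ X) :
    X.inf S.dealerFamily =
      Setoid.ker fun (w : S.Values) (i : {y // y ∈ X}) => w.2 i.1 := by
  ext w w'
  rw [finset_inf_rel, Setoid.ker_def, funext_iff, Subtype.forall]
  refine forall₂_congr fun i hi => ?_
  rw [dealerFamily, if_neg (show i ≠ 0 from fun h => hX (h ▸ hi)), Setoid.ker_def]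

lemma dealerEntropy_of_notMem {X : Finset (Fin 8)} (hX : 0 ∉ X) :
    S.dealerEntropy X = S.Hset X := by
  let := S.mΩ
  let := S.prob
  let := S.shFin
  rw [dealerEntropy, jointEntropy, S.inf_dealerFamily hX]
  exact (shannonEntropy_comp S.μ S.measurableSet_values_preimage _).symm

lemma dealerEntropy_insert {X : Finset (Fin 8)} (hX : 0 ∉ X) :
    S.dealerEntropy (insert 0 X) = S.HsetS X := by
  let := S.mΩ
  let := S.prob
  let := S.secFin
  let := S.shFin
  have : (insert 0 X).inf S.dealerFamily = Setoid.ker fun (w : S.Values) =>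
      ((fun (i : {y // y ∈ X}) => w.2 i.1), w.1) := by
    rw [Finset.inf_insert, S.inf_dealerFamily hX]
    ext w w'
    rw [Setoid.ker_def, Prod.ext_iff]
    exact and_comm
  rw [dealerEntropy, jointEntropy, this]
  exact (shannonEntropy_comp S.μ S.measurableSet_values_preimage fun w : S.Values =>
    ((fun (i : {y // y ∈ X}) => w.2 i.1), w.1)).symm

end Scheme

instance : DecidablePred VamosDep := fun X => by
  unfold VamosDep
  infer_instance

lemma VamosDep.mono {X Y : Finset (Fin 8)} (hX : VamosDep X) (h : X ⊆ Y) : VamosDep Y := by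
  rcases eq_or_ne X Y with rfl | hne
  · exact hX
  · have hlt := Finset.card_lt_card (h.ssubset_of_ne hne)
    have hcard : 4 ≤ X.card := by
      rcases hX with rfl | rfl | rfl | rfl | rfl | hX
      iterate 5 decide
      omega
    exact Or.inr (Or.inr (Or.inr (Or.inr (Or.inr (by omega)))))

lemma vamosQualified_of_circuit {x : Fin 8} {M X : Finset (Fin 8)} (hM : M ⊆ X) (hx : x ∉ M)
    (hdep : VamosDep (insert x M)) (hmin : ∀ y ∈ insert x M, ¬ VamosDep ((insert x M).erase y)) :
    VamosQualified x X := by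
  refine Or.inr ⟨M, hM, hx, hdep, fun Y hY hYdep => ?_⟩
  obtain ⟨y, hy, hyY⟩ := Finset.exists_of_ssubset hY
  exact hmin y hy (hYdep.mono (Finset.subset_erase.2 ⟨hY.1, hyY⟩))

lemma not_vamosQualified_of_not_dep {x : Fin 8} {X : Finset (Fin 8)} (hx : x ∉ X)
    (h : ¬ VamosDep (insert x X)) : ¬ VamosQualified x X := by
  rintro (hxX | ⟨M, hM, -, hC⟩)
  · exact hx hxX
  · exact h (hC.1.mono (Finset.insert_subset_insert x hM))

lemma not_vamosQualified_of_dep {x : Fin 8} {X : Finset (Fin 8)} (hx : x ∉ X) (hX : VamosDep X)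
    (h : ∀ y ∈ X, ¬ VamosDep (insert x (X.erase y))) : ¬ VamosQualified x X := by
  rintro (hxX | ⟨M, hM, -, hC⟩)
  · exact hx hxX
  · rcases eq_or_ne M X with rfl | hne
    · exact hC.2 M (Finset.ssubset_insert hx) hX
    · obtain ⟨y, hy, hyM⟩ := Finset.exists_of_ssubset (hM.ssubset_of_ne hne)
      exact h y hy (hC.1.mono (Finset.insert_subset_insert x (Finset.subset_erase.2 ⟨hM, hyM⟩)))

set_option maxHeartbeats 1000000 in
/-- The share-size bound for the access structure with dealer `0`, from Shannon's inequalities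
and one instance of the Zhang–Yeung inequality. -/
lemma vamos_share_bound {h : Finset (Fin 8) → ℝ} {s c : ℝ}
    (empty : h ∅ = 0)
    (mono : ∀ {I J : Finset (Fin 8)}, I ⊆ J → h I ≤ h J)
    (submodular : ∀ (I J : Finset (Fin 8)) {L : Finset (Fin 8)}, L ⊆ I → L ⊆ J →
      h (I ∪ J) + h L ≤ h I + h J)
    (zhangYeung : ∀ A B C D : Finset (Fin 8),
      2 * (h C + h D - h (C ∪ D)) ≤
        (h A + h B - h (A ∪ B)) + (h A + h (C ∪ D) - h (A ∪ (C ∪ D)))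
        + 3 * (h (A ∪ C) + h (A ∪ D) - h (A ∪ (C ∪ D)) - h A)
        + (h (B ∪ C) + h (B ∪ D) - h (B ∪ (C ∪ D)) - h B))
    (qualified : ∀ X : Finset (Fin 8), 0 ∉ X → VamosQualified 0 X → h (insert 0 X) = h X)
    (unqualified : ∀ X : Finset (Fin 8), 0 ∉ X → ¬ VamosQualified 0 X →
      h (insert 0 X) = h X + s)
    (share_le : ∀ i : Fin 8, i ≠ 0 → h {i} ≤ c) :
    9 * s ≤ 8 * c := by
  have sub (I J K L : Finset (Fin 8)) (hL : L ⊆ I ∧ L ⊆ J ∧ I ∪ J = K) :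
      h K + h L ≤ h I + h J := hL.2.2 ▸ submodular I J hL.1 hL.2.1
  have qual (X Y M : Finset (Fin 8)) (hX : 0 ∉ X ∧ insert 0 X = Y ∧ M ⊆ X ∧ 0 ∉ M ∧
      VamosDep (insert 0 M) ∧ ∀ y ∈ insert 0 M, ¬ VamosDep ((insert 0 M).erase y)) :
      h Y = h X :=
    hX.2.1 ▸ qualified X hX.1
      (vamosQualified_of_circuit hX.2.2.1 hX.2.2.2.1 hX.2.2.2.2.1 hX.2.2.2.2.2)
  have unqual (X Y : Finset (Fin 8))
      (hX : 0 ∉ X ∧ insert 0 X = Y ∧ ¬ VamosDep (insert 0 X)) : h Y = h X + s :=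
    hX.2.1 ▸ unqualified X hX.1 (not_vamosQualified_of_not_dep hX.1 hX.2.2)
  have unqual_of_dep (X Y : Finset (Fin 8))
      (hX : 0 ∉ X ∧ insert 0 X = Y ∧ VamosDep X ∧ ∀ y ∈ X, ¬ VamosDep (insert 0 (X.erase y))) :
      h Y = h X + s :=
    hX.2.1 ▸ unqualified X hX.1 (not_vamosQualified_of_dep hX.1 hX.2.2.1 hX.2.2.2)
  have zy := zhangYeung {0, 1} {6, 7} {2, 3} {4, 5}
  rw [
    show ({0, 1} ∪ {6, 7} : Finset (Fin 8)) = {0, 1, 6, 7} by decide,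
    show ({2, 3} ∪ {4, 5} : Finset (Fin 8)) = {2, 3, 4, 5} by decide,
    show ({0, 1} ∪ {2, 3} : Finset (Fin 8)) = {0, 1, 2, 3} by decide,
    show ({0, 1} ∪ {4, 5} : Finset (Fin 8)) = {0, 1, 4, 5} by decide,
    show ({6, 7} ∪ {2, 3} : Finset (Fin 8)) = {2, 3, 6, 7} by decide,
    show ({6, 7} ∪ {4, 5} : Finset (Fin 8)) = {4, 5, 6, 7} by decide,
    show ({0, 1} ∪ {2, 3, 4, 5} : Finset (Fin 8)) = {0, 1, 2, 3, 4, 5} by decide,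
    show ({6, 7} ∪ {2, 3, 4, 5} : Finset (Fin 8)) = {2, 3, 4, 5, 6, 7} by decide] at zy
  linear_combination
    (share_le 2 (by decide))
    + 3 * (sub {2} {1} {1, 2} ∅ (by decide +kernel))
    + (sub {1, 2, 4, 5, 6, 7} {1, 2, 3, 4, 5, 7} {1, 2, 3, 4, 5, 6, 7} {1, 2, 4, 5, 7}
      (by decide +kernel))
    + (sub {3} {2} {2, 3} ∅ (by decide +kernel))
    + 3 * (sub {2, 3} {1, 2} {1, 2, 3} {2} (by decide +kernel))
    + (share_le 4 (by decide))
    + (share_le 5 (by decide))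
    + (sub {5} {4} {4, 5} ∅ (by decide +kernel))
    + 3 * (sub {4, 5} {1, 5} {1, 4, 5} {5} (by decide +kernel))
    + 2 * (sub {5} {1} {1, 5} ∅ (by decide +kernel))
    + 3 * (sub {2, 3, 4, 5, 6, 7} {1, 2, 3, 4, 5, 7} {1, 2, 3, 4, 5, 6, 7} {2, 3, 4, 5, 7}
      (by decide +kernel))
    + (mono (by decide +kernel : ({0, 1, 2, 3, 4, 6, 7} : Finset (Fin 8))
      ⊆ {0, 1, 2, 3, 4, 5, 6, 7}))
    + (mono (by decide +kernel : ({0, 1, 2, 3, 5, 6, 7} : Finset (Fin 8))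
      ⊆ {0, 1, 2, 3, 4, 5, 6, 7}))
    + (sub {7} {5} {5, 7} ∅ (by decide +kernel))
    + (mono (by decide +kernel : ({0, 1, 2, 4, 5, 6, 7} : Finset (Fin 8))
      ⊆ {0, 1, 2, 3, 4, 5, 6, 7}))
    + (sub {1, 5, 7} {1, 2, 5} {1, 2, 5, 7} {1, 5} (by decide +kernel))
    + (sub {5, 7} {1, 7} {1, 5, 7} {7} (by decide +kernel))
    + (sub {1, 2, 3, 5, 7} {1, 2, 3, 4, 5} {1, 2, 3, 4, 5, 7} {1, 2, 3, 5} (by decide +kernel))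
    + (sub {0, 1, 2, 5, 7} {0, 1, 2, 3, 5} {0, 1, 2, 3, 5, 7} {0, 1, 2, 5} (by decide +kernel))
    + (sub {2, 3, 4, 5, 6, 7} {1, 2, 3, 5, 6, 7} {1, 2, 3, 4, 5, 6, 7} {2, 3, 5, 6, 7}
      (by decide +kernel))
    + (sub {1, 3, 4, 5, 6, 7} {1, 2, 3, 4, 5, 7} {1, 2, 3, 4, 5, 6, 7} {1, 3, 4, 5, 7}
      (by decide +kernel))
    + (sub {1, 3, 4, 5, 7} {1, 2, 4, 5, 7} {1, 2, 3, 4, 5, 7} {1, 4, 5, 7} (by decide +kernel))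
    + 3 * (sub {0, 2, 3, 4, 5, 7} {0, 1, 2, 3, 4, 5} {0, 1, 2, 3, 4, 5, 7} {0, 2, 3, 4, 5}
      (by decide +kernel))
    + (sub {1, 6, 7} {1, 4, 7} {1, 4, 6, 7} {1, 7} (by decide +kernel))
    + (sub {0, 1, 4, 6, 7} {0, 1, 4, 5, 7} {0, 1, 4, 5, 6, 7} {0, 1, 4, 7} (by decide +kernel))
    + 4 * (mono (by decide +kernel : ({0, 2, 3, 4, 5, 6, 7} : Finset (Fin 8))
      ⊆ {0, 1, 2, 3, 4, 5, 6, 7}))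
    + (sub {0, 2, 3, 5, 6, 7} {0, 2, 3, 4, 6, 7} {0, 2, 3, 4, 5, 6, 7} {0, 2, 3, 6, 7}
      (by decide +kernel))
    + zy
    + (sub {2, 3, 4, 5, 6, 7} {1, 3, 4, 5, 6, 7} {1, 2, 3, 4, 5, 6, 7} {3, 4, 5, 6, 7}
      (by decide +kernel))
    + (share_le 3 (by decide))
    + (mono (by decide +kernel : ({0, 1, 3, 4, 5, 6, 7} : Finset (Fin 8))
      ⊆ {0, 1, 2, 3, 4, 5, 6, 7}))
    + (sub {0, 3, 4, 5, 6, 7} {0, 1, 4, 5, 6, 7} {0, 1, 3, 4, 5, 6, 7} {0, 4, 5, 6, 7}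
      (by decide +kernel))
    + (sub {2, 3, 4, 5, 6, 7} {1, 2, 3, 4, 6, 7} {1, 2, 3, 4, 5, 6, 7} {2, 3, 4, 6, 7}
      (by decide +kernel))
    + 4 * (share_le 1 (by decide))
    - 8 * empty
    - (unqual {1} {0, 1} (by decide +kernel))
    + 3 * (qual {1, 2, 3} {0, 1, 2, 3} {1, 2, 3} (by decide +kernel))
    - (unqual {1, 2, 5} {0, 1, 2, 5} (by decide +kernel))
    + 3 * (qual {1, 4, 5} {0, 1, 4, 5} {1, 4, 5} (by decide +kernel))
    - (unqual {1, 4, 7} {0, 1, 4, 7} (by decide +kernel))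
    - (unqual {1, 6, 7} {0, 1, 6, 7} (by decide +kernel))
    + (qual {1, 2, 3, 5} {0, 1, 2, 3, 5} {1, 2, 3} (by decide +kernel))
    - 3 * (unqual_of_dep {2, 3, 4, 5} {0, 2, 3, 4, 5} (by decide +kernel))
    + (qual {1, 2, 5, 7} {0, 1, 2, 5, 7} {1, 2, 5, 7} (by decide +kernel))
    + (qual {1, 4, 5, 7} {0, 1, 4, 5, 7} {1, 4, 5} (by decide +kernel))
    - (unqual_of_dep {2, 3, 6, 7} {0, 2, 3, 6, 7} (by decide +kernel))
    + (qual {1, 4, 6, 7} {0, 1, 4, 6, 7} {1, 4, 6, 7} (by decide +kernel))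
    - (unqual_of_dep {4, 5, 6, 7} {0, 4, 5, 6, 7} (by decide +kernel))
    - (qual {1, 2, 3, 4, 5} {0, 1, 2, 3, 4, 5} {1, 2, 3} (by decide +kernel))
    - (qual {1, 2, 3, 5, 7} {0, 1, 2, 3, 5, 7} {1, 2, 3} (by decide +kernel))
    + 3 * (qual {2, 3, 4, 5, 7} {0, 2, 3, 4, 5, 7} {2, 3, 4, 7} (by decide +kernel))
    + (qual {2, 3, 4, 6, 7} {0, 2, 3, 4, 6, 7} {2, 3, 4, 6} (by decide +kernel))
    + (qual {2, 3, 5, 6, 7} {0, 2, 3, 5, 6, 7} {2, 3, 5, 6} (by decide +kernel))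
    + (qual {3, 4, 5, 6, 7} {0, 3, 4, 5, 6, 7} {3, 4, 5, 6} (by decide +kernel))
    - 3 * (qual {1, 2, 3, 4, 5, 7} {0, 1, 2, 3, 4, 5, 7} {1, 2, 3} (by decide +kernel))
    - (qual {1, 2, 3, 4, 6, 7} {0, 1, 2, 3, 4, 6, 7} {1, 2, 3} (by decide +kernel))
    - (qual {1, 2, 3, 5, 6, 7} {0, 1, 2, 3, 5, 6, 7} {1, 2, 3} (by decide +kernel))
    - (qual {1, 2, 4, 5, 6, 7} {0, 1, 2, 4, 5, 6, 7} {1, 4, 5} (by decide +kernel))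
    - 2 * (qual {1, 3, 4, 5, 6, 7} {0, 1, 3, 4, 5, 6, 7} {1, 4, 5} (by decide +kernel))
    - 5 * (qual {2, 3, 4, 5, 6, 7} {0, 2, 3, 4, 5, 6, 7} {2, 3, 4, 6} (by decide +kernel))
    + 8 * (qual {1, 2, 3, 4, 5, 6, 7} {0, 1, 2, 3, 4, 5, 6, 7} {1, 2, 3} (by decide +kernel))

lemma Scheme.share_entropy_bound {S : Scheme (Fin 8)} (hS : S.IsPerfect (VamosQualified 0)) {c : ℝ}
    (hc : ∀ i : Fin 8, S.Hset {i} ≤ c) : 9 * S.Hsec ≤ 8 * c := by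
  refine vamos_share_bound (h := S.dealerEntropy)
    (jointEntropy_empty _ S.sum_jointLaw)
    (jointEntropy_mono _ S.jointLaw_nonneg)
    (jointEntropy_submodular _ S.jointLaw_nonneg)
    (jointEntropy_zhangYeung S.jointLaw_nonneg S.sum_jointLaw _)
    (fun X h0 hX => ?_) (fun X h0 hX => ?_) (fun i hi => ?_)
  · rw [S.dealerEntropy_insert h0, S.dealerEntropy_of_notMem h0]
    linarith [hS.1 X hX]
  · rw [S.dealerEntropy_insert h0, S.dealerEntropy_of_notMem h0]
    linarith [hS.2 X hX]
  · rw [S.dealerEntropy_of_notMem (by simpa using hi.symm)]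
    exact hc i

/-- Every perfect secret sharing scheme for `V₁ = Γ_{v₁}` (dealer `v₁`, i.e. `(0 : Fin 8)`)
has information rate `ρ(Σ) ≤ 19/21`; consequently
`ρ(V₁) = sup {ρ(Σ) | Σ a perfect scheme for V₁} ≤ 19/21`. -/
theorem V1_rate_le :
    (∀ S : Scheme (Fin 8),
        S.IsPerfect (VamosQualified 0) → 0 < S.Hsec → S.rho ≤ 19 / 21) ∧
    sSup {r : ℝ | ∃ S : Scheme (Fin 8),
        S.IsPerfect (VamosQualified 0) ∧ 0 < S.Hsec ∧ S.rho = r} ≤ 19 / 21 := by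
  have rate_le (S : Scheme (Fin 8)) (hS : S.IsPerfect (VamosQualified 0)) (hpos : 0 < S.Hsec) :
      S.rho ≤ 19 / 21 := by
    by_contra! hlt
    have hshare (i : Fin 8) : S.Hset {i} ≤ 21 / 19 * S.Hsec := by
      have hi : 19 / 21 < S.Hsec / S.Hset {i} :=
        hlt.trans_le (Finset.inf'_le _ (Finset.mem_univ i))
      have hH : 0 < S.Hset {i} := by
        by_contra! h
        linarith [div_nonpos_of_nonneg_of_nonpos hpos.le h]
      rw [lt_div_iff₀ hH] at hi
      linarith
    linarith [Scheme.share_entropy_bound hS hshare]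
  refine ⟨rate_le, Real.sSup_le ?_ (by norm_num)⟩
  rintro _ ⟨S, hS, hpos, rfl⟩
  exact rate_le S hS hpos
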